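/- arXiv:1511.00550 — 7 statements merged into one kernel-verified Lean document; each statement's English description precedes it below -/
import Mathlib

section
/- Let k be an algebraically closed field, and let O be a Noetherian regular local ring which is a k-algebra whose structure map induces an isomorphism of k onto the residue field O/m. Let g be a k-algebra automorphism of O of finite order N, where N is invertible in k. Then there exist N-th roots of unity ζ_1, …, ζ_d in k^* and elements x_1, …, x_d of O generating the maximal ideal m, where d is the Krull dimension of O, such that g(x_i) = ζ_i · x_i for every i (scalar multiplication via the k-algebra structure). -/
open Finset in
/-- If `ζ` is a primitive `N`-th root of unity, the discrete Fourier coefficients of the orbit of `y`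
under an automorphism sum to `N • y`. -/
theorem sum_sum_pow_smul_pow_apply {k O : Type*} [Field k] [CommRing O] [Algebra k O]
    (g : O ≃ₐ[k] O) {N : ℕ} {ζ : k} (hζ : IsPrimitiveRoot ζ N) (hN : 0 < N) (y : O) :
    ∑ i ∈ range N, ∑ j ∈ range N, (ζ ^ i) ^ j • (g ^ j) y = (N : k) • y := by
  rw [sum_comm, sum_eq_single_of_mem 0 (mem_range.2 hN)]
  · simp [← Nat.cast_smul_eq_nsmul k]
  · intro j hj hj0
    have h1 : ζ ^ j ≠ 1 := hζ.pow_ne_one_of_pos_of_lt hj0 (mem_range.1 hj)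
    have h2 : ∑ i ∈ range N, (ζ ^ j) ^ i = 0 := by
      rw [geom_sum_eq h1, ← pow_mul, mul_comm, pow_mul, hζ.pow_eq_one, one_pow, sub_self, zero_div]
    rw [← sum_smul]
    simp_rw [← pow_mul, mul_comm _ j, pow_mul]
    rw [h2, zero_smul]

open Finset in
/-- The discrete Fourier coefficients of the orbit of `y` are eigenvectors. -/
theorem apply_sum_pow_smul_pow_apply {k O : Type*} [Field k] [CommRing O] [Algebra k O]
    (g : O ≃ₐ[k] O) {N : ℕ} (hg : g ^ N = 1) {η : k} (hη0 : η ≠ 0) (hη : η ^ N = 1) (y : O) :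
    g (∑ j ∈ range N, η ^ j • (g ^ j) y) = η⁻¹ • ∑ j ∈ range N, η ^ j • (g ^ j) y := by
  have h : ∑ j ∈ range N, η ^ (j + 1) • (g ^ (j + 1)) y = ∑ j ∈ range N, η ^ j • (g ^ j) y := by
    have h1 := sum_range_succ (fun j ↦ η ^ j • (g ^ j) y) N
    rw [sum_range_succ', hη, hg, pow_zero, pow_zero] at h1
    exact add_right_cancel h1
  conv_rhs => rw [← h]
  rw [map_sum, smul_sum]
  refine sum_congr rfl fun j _ ↦ ?_
  rw [map_smul, smul_smul, pow_succ' η, inv_mul_cancel_left₀ hη0, pow_succ' g]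
  rfl

/-- An algebra automorphism of a local ring preserves the maximal ideal. -/
theorem AlgEquiv.apply_mem_maximalIdeal {k O : Type*} [CommRing k] [CommRing O] [IsLocalRing O]
    [Algebra k O] (g : O ≃ₐ[k] O) {y : O} (hy : y ∈ IsLocalRing.maximalIdeal O) :
    g y ∈ IsLocalRing.maximalIdeal O := by
  rw [IsLocalRing.mem_maximalIdeal, mem_nonunits_iff] at *
  rwa [MulEquiv.isUnit_map]

open IsLocalRing in
/-- Every generating set of the maximal ideal of a regular local ring of dimension `d` contains
a generating family of length `d`. -/
theorem IsRegularLocalRing.exists_fin_span_range_eq_maximalIdeal {O : Type*} [CommRing O]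
    [IsRegularLocalRing O] {d : ℕ} (hdim : ringKrullDim O = d) {E : Set O}
    (hE : Ideal.span E = maximalIdeal O) :
    ∃ x : Fin d → O, (∀ i, x i ∈ E) ∧ Ideal.span (Set.range x) = maximalIdeal O := by
  let E' : Set (maximalIdeal O) := Subtype.val ⁻¹' E
  have key (s : Set (maximalIdeal O)) :
      Submodule.span O s = ⊤ ↔ Ideal.span (Subtype.val '' s) = maximalIdeal O := by
    rw [← (Submodule.map_injective_of_injective (maximalIdeal O).subtype_injective).eq_iff,
      Submodule.map_span, Submodule.map_subtype_top]
    rfl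
  have hE' : Submodule.span O E' = ⊤ := by
    rw [key, Set.image_preimage_eq_of_subset, hE]
    simp [← hE]
  have hV := CotangentSpace.span_image_eq_top_iff.2 hE'
  have hd : Module.finrank (ResidueField O) (CotangentSpace O) = d := by
    have := (IsRegularLocalRing.iff_finrank_cotangentSpace O).1 inferInstance
    rw [hdim] at this
    exact_mod_cast this
  obtain ⟨f, hf, hfs, -⟩ := Submodule.exists_fun_fin_finrank_span_eq (ResidueField O)
    ((maximalIdeal O).toCotangent '' E')
  have hcard : Module.finrank (ResidueField O) (Submodule.span (ResidueField O)
      ((maximalIdeal O).toCotangent '' E')) = d := by rw [hV, finrank_top, hd]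
  choose x hxE hx using hf
  refine ⟨fun i ↦ x (i.cast hcard.symm), fun i ↦ hxE _, ?_⟩
  have hrange : Set.range (fun i : Fin d ↦ (x (i.cast hcard.symm) : O)) =
      Subtype.val '' Set.range x := by
    rw [← Set.range_comp]
    exact (finCongr hcard.symm).surjective.range_comp (Subtype.val ∘ x)
  rw [hrange, ← key, ← CotangentSpace.span_image_eq_top_iff, ← Set.range_comp]
  convert hfs.trans hV
  exact funext hx

/-- Let `k` be an algebraically closed field and `O` a Noetherian regular
local `k`-algebra whose structure map induces an isomorphism of `k` onto the residue field
`O/m`.  (Regularity is encoded as: the maximal ideal `m` can be generated by `d` elements,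
where `d` is the Krull dimension of `O`.)  If `g` is a `k`-algebra automorphism of `O` with
`g ^ N = 1` for some `N` invertible in `k`, then there are `N`-th roots of unity
`ζ₁, …, ζ_d ∈ k` and elements `x₁, …, x_d` generating `m` with `g (x i) = ζ i • x i`. -/
theorem stmt0
    (k : Type*) [Field k] [IsAlgClosed k]
    (O : Type*) [CommRing O] [IsNoetherianRing O] [IsLocalRing O] [Algebra k O]
    (hres : Function.Bijective ((IsLocalRing.residue O).comp (algebraMap k O)))
    (d : ℕ) (hdim : ringKrullDim O = d)
    (hreg : ∃ s : Finset O, s.card = d ∧ Ideal.span (s : Set O) = IsLocalRing.maximalIdeal O)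
    (g : O ≃ₐ[k] O) (N : ℕ) (hN : 0 < N) (hNk : IsUnit (N : k)) (hg : g ^ N = 1) :
    ∃ (ζ : Fin d → k) (x : Fin d → O),
      (∀ i, ζ i ^ N = 1) ∧
      Ideal.span (Set.range x) = IsLocalRing.maximalIdeal O ∧
      ∀ i, g (x i) = ζ i • x i := by
  have : NeZero (N : k) := ⟨hNk.ne_zero⟩
  have : IsRegularLocalRing O := by
    obtain ⟨s, hs, hspan⟩ := hreg
    refine .of_spanFinrank_maximalIdeal_le O ?_
    rw [hdim, ← hs, ← hspan]
    have := Submodule.spanFinrank_span_le_ncard_of_finite (R := O) s.finite_toSet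
    rw [Set.ncard_coe_finset] at this
    exact_mod_cast this
  obtain ⟨ζ, hζ⟩ := HasEnoughRootsOfUnity.exists_primitiveRoot k N
  have hpow (j : ℕ) {y : O} (hy : y ∈ IsLocalRing.maximalIdeal O) :
      (g ^ j) y ∈ IsLocalRing.maximalIdeal O := (g ^ j).apply_mem_maximalIdeal hy
  let E : Set O := {x | x ∈ IsLocalRing.maximalIdeal O ∧ ∃ ξ : k, ξ ^ N = 1 ∧ g x = ξ • x}
  have hE : Ideal.span E = IsLocalRing.maximalIdeal O := by
    refine le_antisymm (Ideal.span_le.2 fun x hx ↦ hx.1) fun y hy ↦ ?_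
    rw [← inv_smul_smul₀ hNk.ne_zero y, ← sum_sum_pow_smul_pow_apply g hζ hN y]
    refine Submodule.smul_of_tower_mem _ _ (Ideal.sum_mem _ fun i _ ↦ Ideal.subset_span ⟨?_, ?_⟩)
    · exact Ideal.sum_mem _ fun j _ ↦ Submodule.smul_of_tower_mem _ _ (hpow j hy)
    · have hη : (ζ ^ i) ^ N = 1 := by rw [← pow_mul, mul_comm, pow_mul, hζ.pow_eq_one, one_pow]
      exact ⟨(ζ ^ i)⁻¹, by rw [inv_pow, hη, inv_one],
        apply_sum_pow_smul_pow_apply g hg (pow_ne_zero _ (hζ.ne_zero hN.ne')) hη y⟩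
  obtain ⟨x, hx, hspan⟩ :=
    IsRegularLocalRing.exists_fin_span_range_eq_maximalIdeal hdim hE
  choose ξ hξ hgx using fun i ↦ (hx i).2
  exact ⟨ξ, x, hξ, hspan, hgx⟩
end

section
/- Let k be a field, n ≥ 0, and G a finite group whose order is invertible in k, acting on the formal power series ring R = k[[X_1, …, X_n]] by k-algebra automorphisms. Then the action is linearizable: there exists a k-algebra automorphism ψ of R such that for every g ∈ G and every i, the element (ψ^{−1} ∘ g ∘ ψ)(X_i) lies in the k-linear span of X_1, …, X_n (i.e., the conjugated action of each g sends each variable to a homogeneous linear form). -/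
open MvPowerSeries

namespace MvPowerSeries

section CommRing

variable {σ R : Type*} [CommRing R]

/-- The submodule of power series of order at least `N`. -/
def orderSubmodule (σ R : Type*) [CommRing R] (N : ℕ) : Submodule R (MvPowerSeries σ R) where
  carrier := {f | (N : ℕ∞) ≤ f.order}
  add_mem' ha hb := (le_min ha hb).trans min_order_le_add
  zero_mem' := by simp
  smul_mem' _ _ h := le_trans h le_order_smul

lemma mem_orderSubmodule {N : ℕ} {f : MvPowerSeries σ R} :
    f ∈ orderSubmodule σ R N ↔ (N : ℕ∞) ≤ f.order := Iff.rfl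

lemma mem_orderSubmodule_iff_coeff {N : ℕ} {f : MvPowerSeries σ R} :
    f ∈ orderSubmodule σ R N ↔ ∀ d : σ →₀ ℕ, d.degree < N → coeff d f = 0 :=
  ⟨fun h _ hd ↦ coeff_of_lt_order ((Nat.cast_lt.2 hd).trans_le h), nat_le_order⟩

lemma orderSubmodule_anti {M N : ℕ} (h : M ≤ N) :
    orderSubmodule σ R N ≤ orderSubmodule σ R M :=
  fun _ hf ↦ mem_orderSubmodule.2 ((Nat.cast_le.2 h).trans (mem_orderSubmodule.1 hf))

lemma mem_orderSubmodule_zero (f : MvPowerSeries σ R) : f ∈ orderSubmodule σ R 0 := by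
  simp [mem_orderSubmodule]

lemma mem_orderSubmodule_one {f : MvPowerSeries σ R} :
    f ∈ orderSubmodule σ R 1 ↔ constantCoeff f = 0 := by
  rw [mem_orderSubmodule, Nat.cast_one, one_le_order_iff_constCoeff_eq_zero]

lemma mul_mem_orderSubmodule {M N : ℕ} {f g : MvPowerSeries σ R}
    (hf : f ∈ orderSubmodule σ R M) (hg : g ∈ orderSubmodule σ R N) :
    f * g ∈ orderSubmodule σ R (M + N) := by
  rw [mem_orderSubmodule, Nat.cast_add]
  exact (add_le_add hf hg).trans le_order_mul

lemma X_mem_orderSubmodule (i : σ) : (X i : MvPowerSeries σ R) ∈ orderSubmodule σ R 1 := by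
  simp [mem_orderSubmodule_one]

lemma eq_zero_of_forall_mem_orderSubmodule {f : MvPowerSeries σ R}
    (h : ∀ N, f ∈ orderSubmodule σ R N) : f = 0 := by
  ext d
  exact mem_orderSubmodule_iff_coeff.1 (h (d.degree + 1)) d (Nat.lt_succ_self _)

/-- A power series of order at least `N + 1` is a combination of the variables with coefficients
of order at least `N`. -/
lemma exists_eq_sum_X_mul [Fintype σ] {N : ℕ} {f : MvPowerSeries σ R}
    (hf : f ∈ orderSubmodule σ R (N + 1)) :
    ∃ h : σ → MvPowerSeries σ R, (∀ i, h i ∈ orderSubmodule σ R N) ∧ f = ∑ i, X i * h i := by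
  classical
  have hne (d : σ →₀ ℕ) (hd : d ≠ 0) : ∃ i, d i ≠ 0 := Finsupp.ne_iff.1 hd
  choose c hc using hne
  have hadd (d : σ →₀ ℕ) (i : σ) : d + Finsupp.single i 1 ≠ 0 := by simp
  let h (i : σ) : MvPowerSeries σ R := fun d ↦
    if c _ (hadd d i) = i then coeff (d + Finsupp.single i 1) f else 0
  have hcoeff (i : σ) (d : σ →₀ ℕ) : coeff d (h i) =
      if c _ (hadd d i) = i then coeff (d + Finsupp.single i 1) f else 0 := rfl
  refine ⟨h, fun i ↦ mem_orderSubmodule_iff_coeff.2 fun d hd ↦ ?_, ?_⟩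
  · rw [hcoeff, mem_orderSubmodule_iff_coeff.1 hf, ite_self]
    simpa using hd
  · ext d
    simp only [map_sum, X, coeff_monomial_mul, one_mul]
    by_cases hd : d = 0
    · subst hd
      rw [mem_orderSubmodule_iff_coeff.1 hf 0 (by simp)]
      exact (Finset.sum_eq_zero fun i _ ↦ by simp).symm
    · have hle : Finsupp.single (c d hd) 1 ≤ d := by
        simpa [Nat.one_le_iff_ne_zero] using hc d hd
      rw [Finset.sum_eq_single (c d hd)]
      · simp only [hle, if_true, hcoeff, tsub_add_cancel_of_le hle]
      · intro i _ hi
        split_ifs with hid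
        · simp only [hcoeff, tsub_add_cancel_of_le hid, hi.symm, if_false]
        · rfl
      · simp

/-- The linear part of a power series. -/
noncomputable def linearPart [Fintype σ] : MvPowerSeries σ R →ₗ[R] MvPowerSeries σ R :=
  ∑ i, (coeff (Finsupp.single i 1)).smulRight (X i)

lemma linearPart_apply [Fintype σ] (f : MvPowerSeries σ R) :
    linearPart f = ∑ i, coeff (Finsupp.single i 1) f • X i := by
  simp [linearPart]

lemma linearPart_mem_span [Fintype σ] (f : MvPowerSeries σ R) :
    linearPart f ∈ Submodule.span R (Set.range (X : σ → MvPowerSeries σ R)) := by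
  rw [linearPart_apply]
  exact Submodule.sum_mem _ fun i _ ↦
    Submodule.smul_mem _ _ (Submodule.subset_span (Set.mem_range_self i))

lemma linearPart_mem_orderSubmodule [Fintype σ] (f : MvPowerSeries σ R) :
    linearPart f ∈ orderSubmodule σ R 1 := by
  rw [linearPart_apply]
  exact Submodule.sum_mem _ fun i _ ↦ Submodule.smul_mem _ _ (X_mem_orderSubmodule i)

lemma linearPart_X [Fintype σ] (i : σ) : linearPart (X i : MvPowerSeries σ R) = X i := by
  classical
  simp [linearPart_apply, coeff_index_single_X]

lemma linearPart_eq_zero [Fintype σ] {f : MvPowerSeries σ R} (hf : f ∈ orderSubmodule σ R 2) :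
    linearPart f = 0 := by
  rw [linearPart_apply]
  refine Finset.sum_eq_zero fun i _ ↦ ?_
  rw [mem_orderSubmodule_iff_coeff.1 hf _ (by simp), zero_smul]

lemma sub_linearPart_mem_orderSubmodule [Fintype σ] {f : MvPowerSeries σ R}
    (hf : f ∈ orderSubmodule σ R 1) : f - linearPart f ∈ orderSubmodule σ R 2 := by
  classical
  refine mem_orderSubmodule_iff_coeff.2 fun d hd ↦ ?_
  by_cases hd0 : d = 0
  · exact mem_orderSubmodule_iff_coeff.1
      (Submodule.sub_mem _ hf (linearPart_mem_orderSubmodule f)) d (by simp [hd0])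
  · obtain ⟨i, hi⟩ := Finsupp.ne_iff.1 hd0
    have hle : Finsupp.single i 1 ≤ d := by
      simpa [Nat.one_le_iff_ne_zero] using hi
    obtain ⟨e, rfl⟩ := exists_add_of_le hle
    have he : e = 0 := by
      rw [← Finsupp.degree_eq_zero_iff]
      rw [map_add, Finsupp.degree_single] at hd
      omega
    subst he
    simp [linearPart_apply, coeff_index_single_X]

/-- An algebra homomorphism mapping the variables into the maximal ideal does not decrease the
order. -/
lemma map_mem_orderSubmodule [Fintype σ] {φ : MvPowerSeries σ R →ₐ[R] MvPowerSeries σ R}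
    (hφ : ∀ i, φ (X i) ∈ orderSubmodule σ R 1) (N : ℕ) {f : MvPowerSeries σ R}
    (hf : f ∈ orderSubmodule σ R N) : φ f ∈ orderSubmodule σ R N := by
  induction N generalizing f with
  | zero => exact mem_orderSubmodule_zero _
  | succ N ih =>
    obtain ⟨h, hh, rfl⟩ := exists_eq_sum_X_mul hf
    rw [map_sum]
    refine Submodule.sum_mem _ fun i _ ↦ ?_
    rw [map_mul, add_comm N]
    exact mul_mem_orderSubmodule (hφ i) (ih (hh i))

/-- An algebra homomorphism that is the identity on variables modulo order two is the identity
on the associated graded ring. -/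
lemma sub_map_mem_orderSubmodule [Fintype σ] {φ : MvPowerSeries σ R →ₐ[R] MvPowerSeries σ R}
    (hφ : ∀ i, X i - φ (X i) ∈ orderSubmodule σ R 2) (N : ℕ) {f : MvPowerSeries σ R}
    (hf : f ∈ orderSubmodule σ R N) : f - φ f ∈ orderSubmodule σ R (N + 1) := by
  have hφ1 (i : σ) : φ (X i) ∈ orderSubmodule σ R 1 := by
    simpa using Submodule.sub_mem _ (X_mem_orderSubmodule i)
      (orderSubmodule_anti one_le_two (hφ i))
  induction N generalizing f with
  | zero =>
    have hf1 : f - algebraMap R _ (constantCoeff f) ∈ orderSubmodule σ R 1 := by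
      simp [mem_orderSubmodule_one, algebraMap_apply]
    have := Submodule.sub_mem _ hf1 (map_mem_orderSubmodule hφ1 1 hf1)
    rwa [map_sub, AlgHom.commutes, sub_sub_sub_cancel_right] at this
  | succ N ih =>
    obtain ⟨h, hh, rfl⟩ := exists_eq_sum_X_mul hf
    rw [map_sum, ← Finset.sum_sub_distrib]
    refine Submodule.sum_mem _ fun i _ ↦ ?_
    have hsplit : X i * h i - φ (X i * h i) =
        (X i - φ (X i)) * h i + φ (X i) * (h i - φ (h i)) := by
      rw [map_mul]; ring
    rw [hsplit]
    refine Submodule.add_mem _ ?_ ?_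
    · have := mul_mem_orderSubmodule (hφ i) (hh i)
      rwa [show 2 + N = N + 1 + 1 by omega] at this
    · have := mul_mem_orderSubmodule (hφ1 i) (ih (hh i))
      rwa [add_comm 1] at this

/-- A linear map that differs from the identity by an order-raising map is bijective. -/
lemma bijective_of_sub_mem_orderSubmodule {φ : MvPowerSeries σ R →ₗ[R] MvPowerSeries σ R}
    (hφ : ∀ N, ∀ f ∈ orderSubmodule σ R N, f - φ f ∈ orderSubmodule σ R (N + 1)) :
    Function.Bijective φ := by
  constructor
  · refine (injective_iff_map_eq_zero φ).2 fun f hf ↦ ?_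
    refine eq_zero_of_forall_mem_orderSubmodule fun N ↦ ?_
    induction N with
    | zero => exact mem_orderSubmodule_zero _
    | succ N ih => simpa [hf] using hφ N f ih
  · intro f
    let r (j : ℕ) : MvPowerSeries σ R := (fun g ↦ g - φ g)^[j] f
    have hsucc (j : ℕ) : r (j + 1) = r j - φ (r j) := Function.iterate_succ_apply' _ _ _
    have hr (j : ℕ) : r j ∈ orderSubmodule σ R j := by
      induction j with
      | zero => exact mem_orderSubmodule_zero _
      | succ j ih => rw [hsucc]; exact hφ j _ ih
    have hsum (N : ℕ) : φ (∑ j ∈ Finset.range N, r j) = f - r N := by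
      induction N with
      | zero => simp [r]
      | succ N ih => rw [Finset.sum_range_succ, map_add, ih, hsucc]; abel
    let F : MvPowerSeries σ R := fun d ↦ ∑ j ∈ Finset.range (d.degree + 1), coeff d (r j)
    have hF (N : ℕ) : F - ∑ j ∈ Finset.range N, r j ∈ orderSubmodule σ R N := by
      refine mem_orderSubmodule_iff_coeff.2 fun d hd ↦ ?_
      rw [map_sub, map_sum, sub_eq_zero]
      change ∑ j ∈ Finset.range (d.degree + 1), coeff d (r j) = _
      refine Finset.sum_subset (Finset.range_mono hd) fun j _ hj ↦ ?_
      rw [Finset.mem_range, not_lt] at hj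
      exact mem_orderSubmodule_iff_coeff.1 (hr j) d hj
    refine ⟨F, sub_eq_zero.1 (eq_zero_of_forall_mem_orderSubmodule fun N ↦ ?_)⟩
    have hφF : φ (F - ∑ j ∈ Finset.range N, r j) ∈ orderSubmodule σ R N := by
      have := Submodule.sub_mem _ (hF N) (orderSubmodule_anti N.le_succ (hφ N _ (hF N)))
      rwa [sub_sub_cancel] at this
    have := Submodule.sub_mem _ hφF (hr N)
    rwa [map_sub, hsum, sub_sub_eq_add_sub, add_sub_right_comm, add_sub_cancel_right] at this

/-- Formal inverse function theorem, for power series tangent to the identity: a tuple congruent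
to the variables modulo order two is the image of the variables under an automorphism. -/
lemma exists_algEquiv_apply_X_eq [Fintype σ] {y : σ → MvPowerSeries σ R}
    (hy : ∀ i, X i - y i ∈ orderSubmodule σ R 2) :
    ∃ ψ : MvPowerSeries σ R ≃ₐ[R] MvPowerSeries σ R, ∀ i, ψ (X i) = y i := by
  have hsubst : HasSubst y := hasSubst_of_constantCoeff_zero fun i ↦ by
    rw [← mem_orderSubmodule_one]
    simpa using Submodule.sub_mem _ (X_mem_orderSubmodule i)
      (orderSubmodule_anti one_le_two (hy i))
  let φ : MvPowerSeries σ R →ₐ[R] MvPowerSeries σ R := substAlgHom hsubst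
  have hX (i : σ) : φ (X i) = y i := substAlgHom_X hsubst i
  have hφ : ∀ N, ∀ f ∈ orderSubmodule σ R N, f - φ f ∈ orderSubmodule σ R (N + 1) :=
    fun N f ↦ sub_map_mem_orderSubmodule (fun i ↦ by rw [hX]; exact hy i) N
  exact ⟨AlgEquiv.ofBijective φ (bijective_of_sub_mem_orderSubmodule (φ := φ.toLinearMap) hφ), hX⟩

end CommRing

section Field

variable {σ k : Type*} [Field k] [Fintype σ]

lemma algEquiv_mem_orderSubmodule (φ : MvPowerSeries σ k ≃ₐ[k] MvPowerSeries σ k)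
    (N : ℕ) {f : MvPowerSeries σ k} (hf : f ∈ orderSubmodule σ k N) :
    φ f ∈ orderSubmodule σ k N := by
  refine map_mem_orderSubmodule (φ := φ.toAlgHom) (fun i ↦ ?_) N hf
  have hX : ¬ IsUnit (X i : MvPowerSeries σ k) := by simp [isUnit_iff_constantCoeff]
  rw [← MulEquiv.isUnit_map φ, isUnit_iff_constantCoeff, isUnit_iff_ne_zero, not_not] at hX
  exact mem_orderSubmodule_one.2 hX

lemma linearPart_algEquiv_linearPart (φ : MvPowerSeries σ k ≃ₐ[k] MvPowerSeries σ k)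
    {f : MvPowerSeries σ k} (hf : f ∈ orderSubmodule σ k 1) :
    linearPart (φ (linearPart f)) = linearPart (φ f) := by
  have := linearPart_eq_zero
    (algEquiv_mem_orderSubmodule φ 2 (sub_linearPart_mem_orderSubmodule hf))
  rw [map_sub, map_sub, sub_eq_zero] at this
  exact this.symm

variable {G : Type*} [Group G] [Fintype G]

/-- The average over the group of the conjugates of the linear part. -/
noncomputable def averagedLinearPart (A : G →* (MvPowerSeries σ k ≃ₐ[k] MvPowerSeries σ k)) :
    MvPowerSeries σ k →ₗ[k] MvPowerSeries σ k :=
  (Fintype.card G : k)⁻¹ • ∑ g : G, (A g).toLinearMap ∘ₗ linearPart ∘ₗ (A g⁻¹).toLinearMap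

variable (A : G →* (MvPowerSeries σ k ≃ₐ[k] MvPowerSeries σ k))

lemma averagedLinearPart_apply (f : MvPowerSeries σ k) :
    averagedLinearPart A f = (Fintype.card G : k)⁻¹ • ∑ g : G, A g (linearPart (A g⁻¹ f)) := by
  simp [averagedLinearPart]

lemma averagedLinearPart_equivariant (h : G) (f : MvPowerSeries σ k) :
    averagedLinearPart A (A h f) = A h (averagedLinearPart A f) := by
  rw [averagedLinearPart_apply, averagedLinearPart_apply, map_smul, map_sum]
  congr 1
  refine (Fintype.sum_equiv (Equiv.mulLeft h) _ _ fun g ↦ ?_).symm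
  rw [Equiv.coe_mulLeft, ← AlgEquiv.mul_apply, ← AlgEquiv.mul_apply, ← map_mul, ← map_mul,
    mul_inv_rev, inv_mul_cancel_right]

lemma averagedLinearPart_mem_orderSubmodule (f : MvPowerSeries σ k) :
    averagedLinearPart A f ∈ orderSubmodule σ k 1 := by
  rw [averagedLinearPart_apply]
  exact Submodule.smul_mem _ _ (Submodule.sum_mem _ fun g _ ↦
    algEquiv_mem_orderSubmodule _ 1 (linearPart_mem_orderSubmodule _))

lemma averagedLinearPart_linearPart {f : MvPowerSeries σ k} (hf : f ∈ orderSubmodule σ k 1) :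
    averagedLinearPart A (linearPart f) = averagedLinearPart A f := by
  simp_rw [averagedLinearPart_apply, linearPart_algEquiv_linearPart _ hf]

lemma linearPart_averagedLinearPart (hG : IsUnit (Fintype.card G : k)) {f : MvPowerSeries σ k}
    (hf : f ∈ orderSubmodule σ k 1) :
    linearPart (averagedLinearPart A f) = linearPart f := by
  have hterm (g : G) : linearPart (A g (linearPart (A g⁻¹ f))) = linearPart f := by
    rw [linearPart_algEquiv_linearPart _ (algEquiv_mem_orderSubmodule _ 1 hf),
      ← AlgEquiv.mul_apply, ← map_mul, mul_inv_cancel, map_one, AlgEquiv.one_apply]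
  simp_rw [averagedLinearPart_apply, map_smul, map_sum, hterm]
  rw [Finset.sum_const, Finset.card_univ, ← Nat.cast_smul_eq_nsmul k, inv_smul_smul₀ hG.ne_zero]

end Field

end MvPowerSeries



/-- A tame action of a finite group `G` (order invertible in `k`) on the
formal power series ring `k[[X₁,…,Xₙ]]` by `k`-algebra automorphisms is linearizable: there
is a `k`-algebra automorphism `ψ` such that each `ψ⁻¹ ∘ g ∘ ψ` sends every variable `Xᵢ`
into the `k`-linear span of the variables. -/
theorem stmt3
    (k : Type*) [Field k] (n : ℕ)
    (G : Type*) [Group G] [Fintype G] (hG : IsUnit ((Fintype.card G : k)))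
    (A : G →* (MvPowerSeries (Fin n) k ≃ₐ[k] MvPowerSeries (Fin n) k)) :
    ∃ ψ : MvPowerSeries (Fin n) k ≃ₐ[k] MvPowerSeries (Fin n) k,
      ∀ (g : G) (i : Fin n),
        ψ.symm (A g (ψ (MvPowerSeries.X i)))
          ∈ Submodule.span k (Set.range (MvPowerSeries.X : Fin n → MvPowerSeries (Fin n) k)) := by
  obtain ⟨ψ, hψ⟩ := exists_algEquiv_apply_X_eq (y := fun i ↦ averagedLinearPart A (X i))
    fun i ↦ by
      have := Submodule.sub_mem _
        (sub_linearPart_mem_orderSubmodule (X_mem_orderSubmodule (R := k) i))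
        (sub_linearPart_mem_orderSubmodule (averagedLinearPart_mem_orderSubmodule A (X i)))
      rwa [linearPart_averagedLinearPart A hG (X_mem_orderSubmodule i),
        sub_sub_sub_cancel_right] at this
  have hlin (f : MvPowerSeries (Fin n) k) :
      ψ (linearPart f) = averagedLinearPart A (linearPart f) := by
    simp only [linearPart_apply, map_sum, map_smul, hψ]
  refine ⟨ψ, fun g i ↦ ?_⟩
  have hconj : ψ (linearPart (A g (X i))) = A g (ψ (X i)) := by
    rw [hlin, averagedLinearPart_linearPart A
      (algEquiv_mem_orderSubmodule _ 1 (X_mem_orderSubmodule i)),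
      averagedLinearPart_equivariant, hψ]
  rw [← hconj, AlgEquiv.symm_apply_apply]
  exact linearPart_mem_span _
end

section
/- Let k be an algebraically closed field and let O be a Noetherian regular local henselian ring which is a k-algebra whose structure map induces an isomorphism of k onto the residue field O/m (so O is strictly henselian). Let G be a finite group whose order is invertible in k, acting on O by k-algebra automorphisms. Let I = (f) be a nonzero principal ideal of O with g(I) = I for every g ∈ G. Then there exist a generator f′ of I and a group homomorphism χ : G → k^* such that g(f′) = χ(g)·f′ for every g ∈ G. -/
open IsLocalRing in
/-- If two scalars act on a nonzero element in the same way modulo the maximal ideal, they agree. -/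
lemma scalar_eq_of_add_mul_eq {k O : Type*} [Field k] [CommRing O] [IsLocalRing O] [Algebra k O]
    {f : O} (hf : f ≠ 0) {a b : k} {x y : O} (hx : x ∈ maximalIdeal O) (hy : y ∈ maximalIdeal O)
    (h : (algebraMap k O a + x) * f = (algebraMap k O b + y) * f) : a = b := by
  by_contra hab
  have hu : IsUnit (algebraMap k O (a - b)) := (sub_ne_zero.2 hab).isUnit.map _
  have hv : IsUnit (algebraMap k O (a - b) + (x - y)) := by
    by_contra hn
    refine (mem_maximalIdeal _).1 ?_ hu
    have := (maximalIdeal O).sub_mem ((mem_maximalIdeal _).2 hn)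
      ((maximalIdeal O).sub_mem hx hy)
    simpa using this
  refine hf (hv.mul_right_eq_zero.1 ?_)
  rw [map_sub]
  linear_combination h

open IsLocalRing in
/-- If a group acts on a local `k`-algebra by automorphisms and multiplies `f ≠ 0` by elements
congruent to scalars, then these scalars form a character. -/
lemma exists_character_of_map_eq_mul {k O G : Type*} [Field k] [CommRing O] [IsLocalRing O]
    [Algebra k O] [Group G] (A : G →* (O ≃ₐ[k] O)) {f : O} (hf : f ≠ 0)
    (h : ∀ g : G, ∃ c : k, ∃ x ∈ maximalIdeal O, A g f = (algebraMap k O c + x) * f) :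
    ∃ χ : G →* kˣ, ∀ g : G, ∃ x ∈ maximalIdeal O,
      A g f = (algebraMap k O (χ g : k) + x) * f := by
  choose c x hx hA using h
  let φ : G →* k :=
    { toFun := c
      map_one' := by
        refine scalar_eq_of_add_mul_eq hf (hx 1) (maximalIdeal O).zero_mem ?_
        rw [← hA 1]
        simp
      map_mul' := fun g h => by
        have hgx : A g (x h) ∈ maximalIdeal O := by
          rw [mem_maximalIdeal, mem_nonunits_iff, MulEquiv.isUnit_map]
          exact hx h
        refine scalar_eq_of_add_mul_eq hf (hx (g * h))
          (y := algebraMap k O (c h) * x g + A g (x h) * (algebraMap k O (c g) + x g))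
          ((maximalIdeal O).add_mem (Ideal.mul_mem_left _ _ (hx g))
            (Ideal.mul_mem_right _ _ hgx)) ?_
        rw [← hA (g * h), map_mul, AlgEquiv.mul_apply, hA h, map_mul, hA g, map_add,
          AlgEquiv.commutes, map_mul]
        ring }
  exact ⟨φ.toHomUnits, fun g => ⟨x g, hx g, hA g⟩⟩


/-- Let `O` be a Noetherian regular local henselian `k`-algebra (`k`
algebraically closed) whose residue field is `k` itself, and let a finite group `G` of order
invertible in `k` act on `O` by `k`-algebra automorphisms.  If a nonzero principal ideal
`I = (f)` is `G`-stable, then `I` admits a generator `f'` on which `G` acts through a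
character `χ : G → k^*`: `g f' = χ(g) • f'` for all `g`. -/
theorem stmt4
    (k : Type*) [Field k] [IsAlgClosed k]
    (O : Type*) [CommRing O] [IsNoetherianRing O] [HenselianLocalRing O] [Algebra k O]
    (hres : Function.Bijective ((IsLocalRing.residue O).comp (algebraMap k O)))
    (d : ℕ) (hdim : ringKrullDim O = d)
    (hreg : ∃ s : Finset O, s.card = d ∧ Ideal.span (s : Set O) = IsLocalRing.maximalIdeal O)
    (G : Type*) [Group G] [Fintype G] (hG : IsUnit ((Fintype.card G : k)))
    (A : G →* (O ≃ₐ[k] O))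
    (f : O) (hf : f ≠ 0)
    (hI : ∀ g : G, Ideal.map (A g) (Ideal.span {f}) = Ideal.span {f}) :
    ∃ (f' : O) (χ : G →* kˣ),
      Ideal.span {f'} = Ideal.span {f} ∧ ∀ g : G, A g f' = (χ g : k) • f' := by
  obtain ⟨χ, hχ⟩ := exists_character_of_map_eq_mul A hf fun g => by
    have hmem : A g f ∈ Ideal.span {f} := by
      rw [← hI g]
      exact Ideal.mem_map_of_mem _ (Ideal.mem_span_singleton_self f)
    obtain ⟨u, hu⟩ := Ideal.mem_span_singleton'.1 hmem
    obtain ⟨c, hc⟩ := hres.2 (IsLocalRing.residue O u)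
    refine ⟨c, u - algebraMap k O c, ?_, by rw [← hu]; ring⟩
    rw [← IsLocalRing.residue_eq_zero_iff, map_sub, ← hc]
    simp
  choose x hx hA using hχ
  let f' : O := ∑ g : G, ((χ g)⁻¹ : kˣ) • A g f
  let m : O := ∑ g : G, algebraMap k O ((χ g)⁻¹ : kˣ) * x g
  have hm : m ∈ IsLocalRing.maximalIdeal O :=
    Ideal.sum_mem _ fun g _ => Ideal.mul_mem_left _ _ (hx g)
  have hf' : f' = (algebraMap k O (Fintype.card G : k) + m) * f := by
    have hterm (g : G) : ((χ g)⁻¹ : kˣ) • A g f =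
        (1 + algebraMap k O ((χ g)⁻¹ : kˣ) * x g) * f := by
      have h1 : algebraMap k O ((χ g)⁻¹ : kˣ) * algebraMap k O (χ g : k) = 1 := by
        rw [← map_mul, Units.inv_mul, map_one]
      rw [Units.smul_def, Algebra.smul_def, hA g]
      linear_combination f * h1
    simp only [f', m, hterm]
    rw [← Finset.sum_mul, Finset.sum_add_distrib]
    simp
  have hunit : IsUnit (algebraMap k O (Fintype.card G : k) + m) := by
    by_contra hn
    refine (IsLocalRing.mem_maximalIdeal _).1 ?_ (hG.map (algebraMap k O))
    simpa using (IsLocalRing.maximalIdeal O).sub_mem ((IsLocalRing.mem_maximalIdeal _).2 hn) hm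
  refine ⟨f', χ, ?_, fun h => ?_⟩
  · rw [hf']
    exact Ideal.span_singleton_mul_left_unit hunit f
  · rw [← Units.smul_def]
    simp only [f', map_sum, Finset.smul_sum]
    refine Fintype.sum_equiv (Equiv.mulLeft h) _ _ fun g => ?_
    simp only [Equiv.coe_mulLeft, map_mul, Units.smul_def, map_smul, AlgEquiv.mul_apply, smul_smul]
    congr 1
    rw [← Units.val_mul, mul_inv_rev, mul_comm (χ g)⁻¹, mul_inv_cancel_left]
end

section
/- Let O be a henselian local ring with maximal ideal m, and let G be a finite group acting on O by ring automorphisms, with the order |G| invertible in O. Suppose u : G → O^× satisfies u(g) ≡ 1 (mod m) for every g ∈ G and the 1-cocycle relation u(gh) = u(g) · g(u(h)) for all g, h ∈ G. Then u is a coboundary: there exists v ∈ O^× with v ≡ 1 (mod m) such that u(g) = v · g(v)^{−1} for every g ∈ G. (Equivalently, H¹(G, 1 + m) = 0.) -/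
/-- The sum of all values of a multiplicative 1-cocycle trivialises it: `u g * g (∑ u) = ∑ u`. -/
theorem mul_map_sum_of_cocycle {O G : Type*} [CommRing O] [Group G] [Fintype G]
    (A : G →* (O ≃+* O)) (u : G → O) (hcoc : ∀ g h : G, u (g * h) = u g * A g (u h)) (g : G) :
    u g * A g (∑ h, u h) = ∑ h, u h := by
  rw [map_sum, Finset.mul_sum]
  simp_rw [← hcoc]
  exact Equiv.sum_comp (Equiv.mulLeft g) u

/-- `H¹(G, 1 + m) = 0` for a henselian local ring `O` with maximal ideal `m`
and a finite group `G` of order invertible in `O` acting by ring automorphisms: every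
1-cocycle `u : G → O^×` with values `≡ 1 (mod m)` is a coboundary `u(g) = v · g(v)⁻¹` with
`v ≡ 1 (mod m)`. -/
theorem stmt5
    (O : Type*) [CommRing O] [HenselianLocalRing O]
    (G : Type*) [Group G] [Fintype G] (hG : IsUnit ((Fintype.card G : O)))
    (A : G →* (O ≃+* O))
    (u : G → Oˣ)
    (hu1 : ∀ g : G, (u g : O) - 1 ∈ IsLocalRing.maximalIdeal O)
    (hcoc : ∀ g h : G, (u (g * h) : O) = (u g : O) * A g (u h : O)) :
    ∃ v : Oˣ, (v : O) - 1 ∈ IsLocalRing.maximalIdeal O ∧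
      ∀ g : G, u g = v * (Units.map (A g : O →* O) v)⁻¹ := by
  obtain ⟨c, hc⟩ := hG
  set s : O := ∑ h, (u h : O) with hs
  have hmem : (↑c⁻¹ : O) * s - 1 ∈ IsLocalRing.maximalIdeal O := by
    have h : (↑c⁻¹ : O) * s - 1 = ↑c⁻¹ * ∑ h, ((u h : O) - 1) := by
      rw [Finset.sum_sub_distrib, ← hs, mul_sub, Finset.sum_const, Finset.card_univ,
        nsmul_one, ← hc, Units.inv_mul]
    rw [h]
    exact Ideal.mul_mem_left _ _ (Ideal.sum_mem _ fun g _ => hu1 g)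
  have hunit : IsUnit ((↑c⁻¹ : O) * s) := by
    by_contra hn
    refine (IsLocalRing.maximalIdeal.isMaximal O).ne_top ((Ideal.eq_top_iff_one _).2 ?_)
    simpa using Ideal.sub_mem _ ((IsLocalRing.mem_maximalIdeal _).2 hn) hmem
  obtain ⟨v, hv⟩ := hunit
  refine ⟨v, hv ▸ hmem, fun g => eq_mul_inv_of_mul_eq (Units.ext ?_)⟩
  have hfix : A g (↑c⁻¹ : O) = ↑c⁻¹ := by
    have h : A g (c : O) = c := by rw [hc, map_natCast]
    refine Units.eq_inv_of_mul_eq_one_right ?_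
    rw [← h, ← map_mul, Units.inv_mul, map_one]
  have hsum := mul_map_sum_of_cocycle A (fun h => (u h : O)) hcoc g
  change (u g : O) * A g (v : O) = v
  rw [hv, map_mul, hfix, mul_left_comm, hs, hsum]
end

section
/- Let k be a field containing a primitive l-th root of unity ζ, where l is a positive integer, and let a_1, …, a_n be integers. Let σ be the k-algebra automorphism of the polynomial ring k[X_1, …, X_n] determined by σ(X_i) = ζ^{a_i}·X_i for every i. Then the subalgebra of σ-invariant polynomials equals the k-linear span of the monomials X_1^{α_1}⋯X_n^{α_n} with l ∣ (a_1 α_1 + … + a_n α_n); in particular it is isomorphic as a k-algebra to the monoid algebra of the submonoid {α ∈ ℕ^n : l ∣ Σ_i a_i α_i} of ℕ^n. -/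
open MvPolynomial

/-- The submonoid `{α ∈ ℕⁿ : l ∣ Σᵢ aᵢ αᵢ}` of `ℕⁿ`. -/
def weightSubmonoid (n : ℕ) (a : Fin n → ℤ) (l : ℕ) : AddSubmonoid (Fin n → ℕ) where
  carrier := {α | (l : ℤ) ∣ ∑ i, a i * (α i : ℤ)}
  zero_mem' := by simp
  add_mem' := by
    intro x y hx hy
    show (l : ℤ) ∣ ∑ i, a i * (((x + y) i : ℕ) : ℤ)
    have : (∑ i, a i * (((x + y) i : ℕ) : ℤ))
        = (∑ i, a i * (x i : ℤ)) + ∑ i, a i * (y i : ℤ) := by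
      rw [← Finset.sum_add_distrib]
      congr 1 with i
      simp only [Pi.add_apply]
      push_cast
      ring
    rw [this]
    exact dvd_add hx hy

theorem MvPolynomial.prod_univ_X_pow {ι R : Type*} [Fintype ι] [CommSemiring R] (α : ι → ℕ) :
    ∏ i, (X i : MvPolynomial ι R) ^ α i = monomial (Finsupp.equivFunOnFinite.symm α) 1 := by
  rw [monomial_eq, C_1, one_mul, Finsupp.prod_fintype _ _ fun _ => pow_zero _]
  simp

/-- A diagonal endomorphism multiplies each monomial by a power of `ζ`. -/
theorem diagonal_monomial {ι k : Type*} [Fintype ι] [Field k] {ζ : k} (hζ : ζ ≠ 0) (a : ι → ℤ)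
    (σ : MvPolynomial ι k →ₐ[k] MvPolynomial ι k) (hσ : ∀ i, σ (X i) = ζ ^ a i • X i)
    (d : ι →₀ ℕ) (c : k) :
    σ (monomial d c) = ζ ^ (∑ i, a i * (d i : ℤ)) • monomial d c := by
  have hz : ∀ s : Finset ι, ζ ^ (∑ i ∈ s, a i * (d i : ℤ)) = ∏ i ∈ s, (ζ ^ a i) ^ d i := by
    classical
    intro s
    induction s using Finset.induction_on with
    | empty => simp
    | insert i s hi ih =>
      rw [Finset.sum_insert hi, Finset.prod_insert hi, zpow_add₀ hζ, ih, zpow_mul, zpow_natCast]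
  rw [hz, monomial_eq, Finsupp.prod_fintype _ _ fun _ => pow_zero _, map_mul, map_prod]
  simp only [map_pow, hσ, smul_pow, Finset.prod_smul, mul_smul_comm]
  rw [← algebraMap_eq, AlgHom.commutes]

theorem coeff_diagonal {ι k : Type*} [Fintype ι] [Field k] {ζ : k} (hζ : ζ ≠ 0) (a : ι → ℤ)
    (σ : MvPolynomial ι k →ₐ[k] MvPolynomial ι k) (hσ : ∀ i, σ (X i) = ζ ^ a i • X i)
    (d : ι →₀ ℕ) (f : MvPolynomial ι k) :
    coeff d (σ f) = ζ ^ (∑ i, a i * (d i : ℤ)) * coeff d f := by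
  classical
  induction f using MvPolynomial.induction_on' with
  | monomial u c =>
    rw [diagonal_monomial hζ a σ hσ, coeff_smul, smul_eq_mul, coeff_monomial]
    split_ifs with h
    · rw [h]
    · simp
  | add p q hp hq => rw [map_add, coeff_add, coeff_add, hp, hq, mul_add]

/-- The invariants of a diagonal endomorphism are spanned by the invariant monomials. -/
theorem diagonal_eq_self_iff_mem_span {ι k : Type*} [Fintype ι] [Field k] {l : ℕ} (hl : 0 < l)
    {ζ : k} (hζ : IsPrimitiveRoot ζ l) (a : ι → ℤ)
    (σ : MvPolynomial ι k →ₐ[k] MvPolynomial ι k) (hσ : ∀ i, σ (X i) = ζ ^ a i • X i)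
    (f : MvPolynomial ι k) :
    σ f = f ↔ f ∈ Submodule.span k {m : MvPolynomial ι k |
      ∃ α : ι → ℕ, (l : ℤ) ∣ (∑ i, a i * (α i : ℤ)) ∧ m = ∏ i, X i ^ α i} := by
  have hspan : {m : MvPolynomial ι k |
      ∃ α : ι → ℕ, (l : ℤ) ∣ (∑ i, a i * (α i : ℤ)) ∧ m = ∏ i, X i ^ α i} =
      (monomial · 1) '' {d : ι →₀ ℕ | (l : ℤ) ∣ ∑ i, a i * (d i : ℤ)} := by
    ext m
    constructor
    · rintro ⟨α, hα, rfl⟩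
      exact ⟨Finsupp.equivFunOnFinite.symm α, hα, (prod_univ_X_pow α).symm⟩
    · rintro ⟨d, hd, rfl⟩
      exact ⟨d, hd, by simp [prod_univ_X_pow]⟩
  rw [hspan, ← restrictSupport_eq_span, mem_restrictSupport_iff, MvPolynomial.ext_iff]
  refine forall_congr' fun d => ?_
  rw [coeff_diagonal (hζ.ne_zero hl.ne') a σ hσ, mul_left_eq_self₀, Finset.mem_coe,
    mem_support_iff, Set.mem_ofPred_eq, hζ.zpow_eq_one_iff_dvd]
  tauto

/-- The inclusion of the monoid algebra of `weightSubmonoid n a l` in the polynomial ring. -/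
noncomputable def weightAlgHom (k : Type*) [Field k] (n : ℕ) (a : Fin n → ℤ) (l : ℕ) :
    AddMonoidAlgebra k (weightSubmonoid n a l) →ₐ[k] MvPolynomial (Fin n) k :=
  AddMonoidAlgebra.mapDomainAlgHom k k
    (((Finsupp.linearEquivFunOnFinite ℕ ℕ (Fin n)).symm.toLinearMap.toAddMonoidHom).comp
      (weightSubmonoid n a l).subtype)

theorem weightAlgHom_single (k : Type*) [Field k] (n : ℕ) (a : Fin n → ℤ) (l : ℕ)
    (α : weightSubmonoid n a l) (c : k) :
    weightAlgHom k n a l (AddMonoidAlgebra.single α c) =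
      monomial (Finsupp.equivFunOnFinite.symm α.1) c :=
  AddMonoidAlgebra.mapDomain_single

theorem weightAlgHom_injective (k : Type*) [Field k] (n : ℕ) (a : Fin n → ℤ) (l : ℕ) :
    Function.Injective (weightAlgHom k n a l) :=
  AddMonoidAlgebra.mapDomain_injective
    ((Finsupp.linearEquivFunOnFinite ℕ ℕ (Fin n)).symm.injective.comp Subtype.val_injective)

theorem toSubmodule_range_weightAlgHom (k : Type*) [Field k] (n : ℕ) (a : Fin n → ℤ) (l : ℕ) :
    Subalgebra.toSubmodule (weightAlgHom k n a l).range =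
      Submodule.span k {m : MvPolynomial (Fin n) k |
        ∃ α : Fin n → ℕ, (l : ℤ) ∣ (∑ i, a i * (α i : ℤ)) ∧ m = ∏ i, X i ^ α i} := by
  apply le_antisymm
  · rintro _ ⟨x, rfl⟩
    induction x using AddMonoidAlgebra.induction_linear with
    | zero => simp
    | add x y hx hy => simpa using add_mem hx hy
    | single α c =>
      have h : weightAlgHom k n a l (AddMonoidAlgebra.single α c) = c • ∏ i, X i ^ α.1 i := by
        rw [weightAlgHom_single, prod_univ_X_pow, smul_monomial, smul_eq_mul, mul_one]
      exact h ▸ Submodule.smul_mem _ c (Submodule.subset_span ⟨α.1, α.2, rfl⟩)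
  · rw [Submodule.span_le]
    rintro _ ⟨α, hα, rfl⟩
    exact ⟨AddMonoidAlgebra.single ⟨α, hα⟩ 1,
      (weightAlgHom_single k n a l ⟨α, hα⟩ 1).trans (prod_univ_X_pow α).symm⟩

/-- Let `ζ ∈ k` be a primitive `l`-th root of unity and let `σ` be the
diagonal automorphism of `k[X₁,…,Xₙ]` with `σ(Xᵢ) = ζ^{aᵢ} • Xᵢ`.  Then the `σ`-invariants
are exactly the `k`-linear span of the monomials `X^α` with `l ∣ Σᵢ aᵢ αᵢ`, and the invariant
subalgebra is isomorphic to the monoid algebra of the submonoid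
`{α ∈ ℕⁿ : l ∣ Σᵢ aᵢ αᵢ}` of `ℕⁿ`. -/
theorem stmt11
    (k : Type*) [Field k] (l : ℕ) (hl : 0 < l)
    (ζ : k) (hζ : IsPrimitiveRoot ζ l)
    (n : ℕ) (a : Fin n → ℤ)
    (σ : MvPolynomial (Fin n) k ≃ₐ[k] MvPolynomial (Fin n) k)
    (hσ : ∀ i : Fin n, σ (X i) = (ζ ^ (a i)) • X i) :
    (∀ f : MvPolynomial (Fin n) k, σ f = f ↔
        f ∈ Submodule.span k {m : MvPolynomial (Fin n) k |
          ∃ α : Fin n → ℕ, (l : ℤ) ∣ (∑ i, a i * (α i : ℤ)) ∧ m = ∏ i, X i ^ α i}) ∧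
    Nonempty ((AlgHom.equalizer (σ : MvPolynomial (Fin n) k →ₐ[k] MvPolynomial (Fin n) k)
          (AlgHom.id k (MvPolynomial (Fin n) k)))
        ≃ₐ[k] AddMonoidAlgebra k (weightSubmonoid n a l)) := by
  have hinv := diagonal_eq_self_iff_mem_span hl hζ a
    (σ : MvPolynomial (Fin n) k →ₐ[k] MvPolynomial (Fin n) k) hσ
  refine ⟨hinv, ⟨?_⟩⟩
  have hrange : AlgHom.equalizer (σ : MvPolynomial (Fin n) k →ₐ[k] MvPolynomial (Fin n) k)
      (AlgHom.id k (MvPolynomial (Fin n) k)) = (weightAlgHom k n a l).range := by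
    ext f
    rw [← Subalgebra.mem_toSubmodule (S := (weightAlgHom k n a l).range),
      toSubmodule_range_weightAlgHom]
    exact hinv f
  exact (Subalgebra.equivOfEq _ _ hrange).trans
    (AlgEquiv.ofInjective _ (weightAlgHom_injective k n a l)).symm
end

section
/- Let k be a field containing a primitive l-th root of unity ζ, where l is a positive integer, and let σ be the k-algebra automorphism of k[x, y] determined by σ(x) = ζ·x and σ(y) = ζ^{−1}·y. Then the subalgebra of σ-invariant polynomials is generated as a k-algebra by the three elements x^l, y^l, and x·y; that is, k[x,y]^σ = k[x^l, y^l, xy]. -/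
open MvPolynomial

/-- An algebra map scaling the two variables by `a` and `b` scales the coefficient
of `x^i y^j` by `a^i b^j`. -/
theorem MvPolynomial.coeff_algHom_of_smul_X {R : Type*} [CommSemiring R]
    (φ : MvPolynomial (Fin 2) R →ₐ[R] MvPolynomial (Fin 2) R) {a b : R}
    (h0 : φ (X 0) = a • X 0) (h1 : φ (X 1) = b • X 1)
    (f : MvPolynomial (Fin 2) R) (d : Fin 2 →₀ ℕ) :
    coeff d (φ f) = a ^ d 0 * b ^ d 1 * coeff d f := by
  induction f using MvPolynomial.induction_on' with
  | monomial e c =>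
    have h : φ (monomial e c) = (a ^ e 0 * b ^ e 1) • monomial e c := by
      rw [monomial_fin_two, mul_assoc, ← smul_eq_C_mul, map_smul, map_mul, map_pow, map_pow, h0, h1, smul_pow, smul_pow,
        smul_mul_smul_comm, smul_comm]
    rw [h, coeff_smul, coeff_monomial, smul_eq_mul]
    split_ifs with hed
    · rw [hed]
    · simp
  | add p q hp hq => rw [map_add, coeff_add, coeff_add, hp, hq, mul_add]

/-- If `ζ^i = ζ^j` for a primitive `l`-th root of unity `ζ`, then `x^i y^j` is a product of powers
of `x^l`, `y^l` and `xy`. -/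
theorem IsPrimitiveRoot.pow_mul_pow_mem {k A : Type*} [Field k] [CommSemiring A] [Algebra k A]
    {l : ℕ} {ζ : k} (hl : 0 < l) (hζ : IsPrimitiveRoot ζ l) {S : Subalgebra k A} {x y : A}
    (hx : x ^ l ∈ S) (hy : y ^ l ∈ S) (hxy : x * y ∈ S) {i j : ℕ} (hij : ζ ^ i = ζ ^ j) :
    x ^ i * y ^ j ∈ S := by
  wlog hle : i ≤ j generalizing x y i j
  · rw [mul_comm]
    exact this hy hx (mul_comm x y ▸ hxy) hij.symm (le_of_not_ge hle)
  obtain ⟨m, rfl⟩ := Nat.exists_eq_add_of_le hle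
  have hm : ζ ^ m = 1 := by
    rw [pow_add] at hij
    exact mul_left_cancel₀ (pow_ne_zero i (hζ.ne_zero hl.ne')) (by rw [← hij, mul_one])
  obtain ⟨n, rfl⟩ := hζ.dvd_of_pow_eq_one m hm
  rw [pow_add, ← mul_assoc, ← mul_pow, pow_mul]
  exact mul_mem (pow_mem hxy i) (pow_mem hy n)

/-- Let `ζ ∈ k` be a primitive `l`-th root of unity and `σ` the
automorphism of `k[x, y]` with `σ(x) = ζ • x`, `σ(y) = ζ⁻¹ • y`.  Then the `σ`-invariant
polynomials form exactly the subalgebra generated by `x^l`, `y^l` and `x·y`. -/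
theorem stmt12
    (k : Type*) [Field k] (l : ℕ) (hl : 0 < l)
    (ζ : k) (hζ : IsPrimitiveRoot ζ l)
    (σ : MvPolynomial (Fin 2) k ≃ₐ[k] MvPolynomial (Fin 2) k)
    (hσx : σ (X 0) = ζ • X 0) (hσy : σ (X 1) = ζ⁻¹ • X 1) :
    ∀ f : MvPolynomial (Fin 2) k, σ f = f ↔
      f ∈ Algebra.adjoin k ({(X 0) ^ l, (X 1) ^ l, X 0 * X 1} : Set (MvPolynomial (Fin 2) k)) := by
  have hζ0 : ζ ≠ 0 := hζ.ne_zero hl.ne'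
  intro f
  constructor
  · intro hf
    rw [f.as_sum]
    refine sum_mem fun d hd => ?_
    rw [mem_support_iff] at hd
    have h := coeff_algHom_of_smul_X (σ : MvPolynomial (Fin 2) k →ₐ[k] _) hσx hσy f d
    rw [AlgEquiv.coe_toAlgHom, hf] at h
    have h1 : ζ ^ d 0 * ζ⁻¹ ^ d 1 = 1 := mul_right_cancel₀ hd (by rw [← h, one_mul])
    rw [inv_pow, ← div_eq_mul_inv, div_eq_one_iff_eq (pow_ne_zero _ hζ0)] at h1
    rw [monomial_fin_two, mul_assoc, ← smul_eq_C_mul]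
    refine Subalgebra.smul_mem _ (hζ.pow_mul_pow_mem hl ?_ ?_ ?_ h1) _ <;>
      exact Algebra.subset_adjoin (by simp)
  · intro hf
    induction hf using Algebra.adjoin_induction with
    | mem p hp =>
      rcases hp with rfl | rfl | rfl
      · rw [map_pow, hσx, smul_pow, hζ.pow_eq_one, one_smul]
      · rw [map_pow, hσy, smul_pow, hζ.inv.pow_eq_one, one_smul]
      · rw [map_mul, hσx, hσy, smul_mul_smul_comm, mul_inv_cancel₀ hζ0, one_smul]
    | algebraMap r => exact σ.commutes r
    | add p q _ _ hp hq => rw [map_add, hp, hq]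
    | mul p q _ _ hp hq => rw [map_mul, hp, hq]
end

section
/- Let k be a field, n ≥ 1, let a_1, …, a_n be positive integers, fix an index i, and suppose k contains a primitive a_i-th root of unity ζ. Let σ be the k-algebra automorphism of k[y_1, …, y_n] determined by σ(y_i) = ζ·y_i and σ(y_j) = ζ^{−a_j}·y_j for j ≠ i. Let R_i be the k-subalgebra of the localization k[x_1, …, x_n][x_i^{−1}] spanned by the Laurent monomials x_1^{α_1}⋯x_n^{α_n}·x_i^{−c} with α ∈ ℕ^n, c ∈ ℕ and a_i·c ≤ a_1α_1 + … + a_nα_n. Then the k-algebra homomorphism k[x_1,…,x_n][x_i^{−1}] → k[y_1,…,y_n][y_i^{−1}] determined by x_i ↦ y_i^{a_i} and x_j ↦ y_j·y_i^{a_j} for j ≠ i restricts to a k-algebra isomorphism from R_i onto the subalgebra of σ-invariants of k[y_1, …, y_n]. -/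
open MvPolynomial

/-- The inverse `x⁻¹` of `x` in the localization `R[x⁻¹]` away from `x`. -/
noncomputable def awayInvSelf (R : Type*) [CommSemiring R] (x : R) : Localization.Away x :=
  IsLocalization.Away.invSelf (S := Localization.Away x) x

theorem algebraMap_mul_awayInvSelf {R : Type*} [CommSemiring R] (x : R) :
    algebraMap R (Localization.Away x) x * awayInvSelf R x = 1 :=
  IsLocalization.Away.mul_invSelf x

section WeightedChart

variable {k ι : Type*} [Field k]

theorem prod_X_pow_eq_monomial_one [Fintype ι] (s : ι →₀ ℕ) :
    ∏ j, (X j : MvPolynomial ι k) ^ s j = monomial s 1 := by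
  rw [monomial_eq, Finsupp.prod_fintype _ _ fun _ => pow_zero _, C_1, one_mul]

theorem algebraMap_away_X_injective (i : ι) :
    Function.Injective
      (algebraMap (MvPolynomial ι k) (Localization.Away (X i : MvPolynomial ι k))) :=
  IsLocalization.injective _ (powers_le_nonZeroDivisors_of_noZeroDivisors (X_ne_zero i))

theorem algebraMap_away_X_smul (i : ι) (r : k) (p : MvPolynomial ι k) :
    algebraMap _ (Localization.Away (X i : MvPolynomial ι k)) (r • p) =
      r • algebraMap _ (Localization.Away (X i : MvPolynomial ι k)) p :=
  map_smul (IsScalarTower.toAlgHom k (MvPolynomial ι k) _) r p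

variable [DecidableEq ι] (a : ι → ℕ) (i : ι)

variable (k) in
/-- The substitution `xᵢ ↦ yᵢ^{aᵢ}`, `xⱼ ↦ yⱼ yᵢ^{aⱼ}` on polynomials. -/
noncomputable def chartMap : MvPolynomial ι k →ₐ[k] MvPolynomial ι k :=
  aeval fun j => if j = i then X i ^ a i else X j * X i ^ a j

variable {a i} in
theorem comp_algebraMap_eq_chartMap
    {Φ : Localization.Away (X i : MvPolynomial ι k) →ₐ[k]
      Localization.Away (X i : MvPolynomial ι k)}
    (hΦ : ∀ j, Φ (algebraMap (MvPolynomial ι k) _ (X j)) =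
      algebraMap (MvPolynomial ι k) _ (if j = i then X i ^ a i else X j * X i ^ a j))
    (p : MvPolynomial ι k) :
    Φ (algebraMap _ _ p) = algebraMap _ _ (chartMap k a i p) := by
  have h : Φ.comp (IsScalarTower.toAlgHom k (MvPolynomial ι k) _) =
      (IsScalarTower.toAlgHom k (MvPolynomial ι k) _).comp (chartMap k a i) :=
    MvPolynomial.algHom_ext fun j => by simpa [chartMap] using hΦ j
  exact DFunLike.congr_fun h p

variable [Fintype ι]

/-- The exponent of the image of `x^s` under `xᵢ ↦ yᵢ^{aᵢ}`, `xⱼ ↦ yⱼ yᵢ^{aⱼ}`. -/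
noncomputable def chartExponent (s : ι →₀ ℕ) : ι →₀ ℕ :=
  s.update i (∑ j, a j * s j)

variable {a} in
theorem chartExponent_injective (hi : 0 < a i) : Function.Injective (chartExponent a i) := by
  intro s t h
  have hne : ∀ j, j ≠ i → s j = t j := fun j hj => by
    simpa [chartExponent, hj] using DFunLike.congr_fun h j
  have hsum : ∑ j, a j * s j = ∑ j, a j * t j := by
    simpa [chartExponent] using DFunLike.congr_fun h i
  rw [← Finset.add_sum_erase _ _ (Finset.mem_univ i),
    ← Finset.add_sum_erase (a := i) _ (fun j => a j * t j) (Finset.mem_univ i),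
    Finset.sum_congr rfl fun j hj => by rw [hne j (Finset.ne_of_mem_erase hj)],
    Nat.add_right_cancel_iff] at hsum
  ext j
  by_cases hj : j = i
  · subst hj
    exact Nat.eq_of_mul_eq_mul_left hi hsum
  · exact hne j hj

theorem chartMap_monomial (s : ι →₀ ℕ) (r : k) :
    chartMap k a i (monomial s r) = monomial (chartExponent a i s) r := by
  rw [chartMap, aeval_monomial, Finsupp.prod_fintype _ _ fun _ => pow_zero _,
    monomial_eq (s := chartExponent a i s), Finsupp.prod_fintype _ _ fun _ => pow_zero _,
    algebraMap_eq]
  congr 1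
  rw [← Finset.mul_prod_erase _ _ (Finset.mem_univ i),
    ← Finset.mul_prod_erase (a := i) _ (fun j => X j ^ chartExponent a i s j)
      (Finset.mem_univ i)]
  have hprod : ∀ j ∈ Finset.univ.erase i,
      (if j = i then (X i : MvPolynomial ι k) ^ a i else X j * X i ^ a j) ^ s j =
        X j ^ chartExponent a i s j * X i ^ (a j * s j) := fun j hj => by
    have hj := Finset.ne_of_mem_erase hj
    simp [chartExponent, hj, mul_pow, pow_mul]
  rw [Finset.prod_congr rfl hprod, Finset.prod_mul_distrib, Finset.prod_pow_eq_pow_sum]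
  simp only [if_true, chartExponent, Finsupp.coe_update, Function.update_self]
  rw [← Finset.add_sum_erase _ _ (Finset.mem_univ i), pow_add, ← pow_mul]
  ring

variable {a} in
theorem chartMap_injective (hi : 0 < a i) : Function.Injective (chartMap k a i) := by
  have hcoeff : ∀ (p : MvPolynomial ι k) (s : ι →₀ ℕ),
      coeff (chartExponent a i s) (chartMap k a i p) = coeff s p := fun p s => by
    induction p using MvPolynomial.induction_on' with
    | monomial t r =>
      simp only [chartMap_monomial, coeff_monomial, (chartExponent_injective i hi).eq_iff]
    | add p q hp hq => rw [map_add, coeff_add, coeff_add, hp, hq]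
  intro p q h
  ext s
  rw [← hcoeff p, ← hcoeff q, h]

variable {a i} in
theorem coeff_diagonal_s14 {ζ : k} {σ : MvPolynomial ι k →ₐ[k] MvPolynomial ι k}
    (hσi : σ (X i) = ζ • X i) (hσj : ∀ j, j ≠ i → σ (X j) = (ζ⁻¹ ^ a j) • X j)
    (p : MvPolynomial ι k) (s : ι →₀ ℕ) :
    coeff s (σ p) = ζ ^ s i * ζ⁻¹ ^ (∑ j ∈ Finset.univ.erase i, a j * s j) * coeff s p := by
  have hmon : ∀ t : ι →₀ ℕ, σ (monomial t 1) =
      (ζ ^ t i * ζ⁻¹ ^ (∑ j ∈ Finset.univ.erase i, a j * t j)) • monomial t 1 := fun t => by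
    rw [← prod_X_pow_eq_monomial_one, map_prod, ← Finset.mul_prod_erase _ _ (Finset.mem_univ i),
      ← Finset.mul_prod_erase (a := i) _ (fun j => X j ^ t j) (Finset.mem_univ i),
      Finset.prod_congr rfl fun j hj => by
        rw [map_pow, hσj j (Finset.ne_of_mem_erase hj), smul_pow, ← pow_mul],
      Finset.prod_smul, Finset.prod_pow_eq_pow_sum, map_pow, hσi, smul_pow,
      smul_mul_smul_comm]
  induction p using MvPolynomial.induction_on' with
  | monomial t r =>
    rw [← mul_one r, ← smul_eq_mul, ← smul_monomial, map_smul, hmon]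
    simp only [coeff_smul, coeff_monomial, smul_eq_mul]
    split_ifs with h
    · subst h; ring
    · ring
  | add p q hp hq => rw [map_add, coeff_add, coeff_add, hp, hq, mul_add]

theorem pow_mul_inv_pow_eq_one_iff {ζ : k} {m : ℕ} (hm : 0 < m) (hζ : IsPrimitiveRoot ζ m)
    (u v : ℕ) : ζ ^ u * ζ⁻¹ ^ v = 1 ↔ u ≡ v [MOD m] := by
  have h0 : ζ ≠ 0 := hζ.ne_zero hm.ne'
  rw [inv_pow, mul_inv_eq_one₀ (pow_ne_zero _ h0), hζ.eq_orderOf]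
  lift ζ to kˣ using h0.isUnit
  rw [orderOf_units, ← pow_eq_pow_iff_modEq]
  norm_cast

variable {a i} in
theorem diagonal_eq_self_iff (hi : 0 < a i) {ζ : k} (hζ : IsPrimitiveRoot ζ (a i))
    {σ : MvPolynomial ι k →ₐ[k] MvPolynomial ι k}
    (hσi : σ (X i) = ζ • X i) (hσj : ∀ j, j ≠ i → σ (X j) = (ζ⁻¹ ^ a j) • X j)
    (p : MvPolynomial ι k) :
    σ p = p ↔
      ∀ s ∈ p.support, s i ≡ ∑ j ∈ Finset.univ.erase i, a j * s j [MOD a i] := by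
  simp only [MvPolynomial.ext_iff, coeff_diagonal_s14 hσi hσj, mem_support_iff,
    ← pow_mul_inv_pow_eq_one_iff hi hζ]
  refine forall_congr' fun s => ⟨fun h hs => (mul_eq_right₀ hs).1 h, fun h => ?_⟩
  by_cases hs : coeff s p = 0
  · rw [hs, mul_zero]
  · rw [h hs, one_mul]

variable {a i} in
/-- The exponents of invariant monomials are those of the images of the Laurent monomials
`x^α xᵢ^{-c}`. -/
theorem modEq_iff_exists_chartExponent (s : ι →₀ ℕ) :
    s i ≡ ∑ j ∈ Finset.univ.erase i, a j * s j [MOD a i] ↔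
      ∃ (α : ι →₀ ℕ) (c : ℕ), s + Finsupp.single i (a i * c) = chartExponent a i α := by
  constructor
  · intro h
    have key : ∃ p c : ℕ, s i + a i * c = a i * p + ∑ j ∈ Finset.univ.erase i, a j * s j := by
      rcases le_total (s i) (∑ j ∈ Finset.univ.erase i, a j * s j) with hle | hle
      · obtain ⟨c, hc⟩ := (Nat.modEq_iff_dvd' hle).1 h
        exact ⟨0, c, by omega⟩
      · obtain ⟨p, hp⟩ := (Nat.modEq_iff_dvd' hle).1 h.symm
        exact ⟨p, 0, by omega⟩
    obtain ⟨p, c, hpc⟩ := key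
    refine ⟨s.update i p, c, ?_⟩
    ext j
    by_cases hj : j = i
    · subst hj
      simp only [chartExponent, Finsupp.coe_update, Finsupp.add_apply, Finsupp.single_eq_same,
        Function.update_self]
      rw [hpc, ← Finset.add_sum_erase _ _ (Finset.mem_univ j), Function.update_self]
      congr 1
      exact Finset.sum_congr rfl fun l hl => by
        rw [Function.update_of_ne (Finset.ne_of_mem_erase hl)]
    · simp [chartExponent, hj]
  · rintro ⟨α, c, h⟩
    have hne : ∀ j, j ≠ i → s j = α j := fun j hj => by
      simpa [chartExponent, hj] using DFunLike.congr_fun h j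
    have hsum : s i + a i * c = ∑ j, a j * α j := by
      simpa [chartExponent] using DFunLike.congr_fun h i
    rw [← Finset.add_sum_erase _ _ (Finset.mem_univ i)] at hsum
    rw [Finset.sum_congr rfl fun j hj => by rw [hne j (Finset.ne_of_mem_erase hj)]]
    have := congrArg (· % a i) hsum
    simpa [Nat.ModEq] using this

variable {a i} {Φ : Localization.Away (X i : MvPolynomial ι k) →ₐ[k]
  Localization.Away (X i : MvPolynomial ι k)}

theorem injective_of_eq_chartMap (hi : 0 < a i)
    (hΦ : ∀ p : MvPolynomial ι k, Φ (algebraMap _ _ p) = algebraMap _ _ (chartMap k a i p)) :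
    Function.Injective Φ := by
  rw [injective_iff_map_eq_zero]
  intro z hz
  obtain ⟨⟨p, q⟩, hpq⟩ :=
    IsLocalization.surj (Submonoid.powers (X i : MvPolynomial ι k)) z
  have hp : algebraMap _ (Localization.Away (X i : MvPolynomial ι k)) (chartMap k a i p) = 0 := by
    rw [← hΦ, ← hpq, map_mul, hz, zero_mul]
  have hp0 : p = 0 := chartMap_injective i hi
    (algebraMap_away_X_injective i (by rw [hp, map_zero, map_zero]))
  subst hp0
  rw [map_zero] at hpq
  exact ((IsLocalization.map_units _ q).mul_left_eq_zero).1 hpq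

theorem map_laurentMonomial
    (hΦ : ∀ p : MvPolynomial ι k, Φ (algebraMap _ _ p) = algebraMap _ _ (chartMap k a i p))
    {s α : ι →₀ ℕ} {c : ℕ} (h : s + Finsupp.single i (a i * c) = chartExponent a i α) :
    Φ (algebraMap (MvPolynomial ι k) _ (∏ j, X j ^ α j) *
        awayInvSelf (MvPolynomial ι k) (X i) ^ c) =
      algebraMap (MvPolynomial ι k) _ (monomial s 1) := by
  have hΦX : Φ (algebraMap (MvPolynomial ι k) _ (X i)) =
      algebraMap (MvPolynomial ι k) _ (X i ^ a i) := by
    rw [hΦ]; simp [chartMap]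
  have hinv := congrArg Φ (algebraMap_mul_awayInvSelf (X i : MvPolynomial ι k))
  rw [map_mul, hΦX, map_one] at hinv
  have hmon : (monomial (chartExponent a i α) 1 : MvPolynomial ι k) =
      monomial s 1 * (X i ^ a i) ^ c := by
    rw [← h, ← pow_mul, X_pow_eq_monomial, monomial_mul, one_mul]
  rw [prod_X_pow_eq_monomial_one, map_mul, map_pow, hΦ, chartMap_monomial, hmon, map_mul,
    map_pow, mul_assoc, ← mul_pow, hinv, one_pow, mul_one]

end WeightedChart

/-- The `i`-th chart of the blow-up of `𝔸ⁿ` with weights `(a₁,…,aₙ)` is the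
quotient of `𝔸ⁿ` by `μ_{aᵢ}` acting with characters `(−a₁,…,1,…,−aₙ)`:  the `k`-algebra map
`Φ : k[x][xᵢ⁻¹] → k[y][yᵢ⁻¹]` determined by `xᵢ ↦ yᵢ^{aᵢ}`, `xⱼ ↦ yⱼ yᵢ^{aⱼ}` restricts to an
isomorphism from the subalgebra `Rᵢ` spanned by the Laurent monomials `x^α xᵢ^{-c}` with
`aᵢ c ≤ Σⱼ aⱼ αⱼ` onto the subalgebra of invariants of the diagonal automorphism `σ` of
`k[y₁,…,yₙ]` with `σ(yᵢ) = ζ • yᵢ` and `σ(yⱼ) = ζ^{-aⱼ} • yⱼ` for `j ≠ i`, where `ζ` is a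
primitive `aᵢ`-th root of unity. -/
theorem stmt14
    (k : Type*) [Field k] (n : ℕ) (hn : 1 ≤ n)
    (a : Fin n → ℕ) (ha : ∀ j, 0 < a j)
    (i : Fin n)
    (ζ : k) (hζ : IsPrimitiveRoot ζ (a i))
    (σ : MvPolynomial (Fin n) k ≃ₐ[k] MvPolynomial (Fin n) k)
    (hσi : σ (X i) = ζ • X i)
    (hσj : ∀ j : Fin n, j ≠ i → σ (X j) = (ζ⁻¹ ^ (a j)) • X j)
    (Φ : Localization.Away (X i : MvPolynomial (Fin n) k) →ₐ[k]
         Localization.Away (X i : MvPolynomial (Fin n) k))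
    (hΦ : ∀ j : Fin n,
      Φ (algebraMap (MvPolynomial (Fin n) k) (Localization.Away (X i : MvPolynomial (Fin n) k))
          (X j)) =
        algebraMap (MvPolynomial (Fin n) k) (Localization.Away (X i : MvPolynomial (Fin n) k))
          (if j = i then X i ^ (a i) else X j * X i ^ (a j))) :
    Set.BijOn Φ
      (↑(Submodule.span k {m : Localization.Away (X i : MvPolynomial (Fin n) k) |
        ∃ (α : Fin n → ℕ) (c : ℕ), a i * c ≤ ∑ j, a j * α j ∧
          m = algebraMap (MvPolynomial (Fin n) k)
                (Localization.Away (X i : MvPolynomial (Fin n) k)) (∏ j, X j ^ α j) *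
              (awayInvSelf (MvPolynomial (Fin n) k) (X i)) ^ c}) : Set _)
      ((algebraMap (MvPolynomial (Fin n) k) (Localization.Away (X i : MvPolynomial (Fin n) k))) ''
        {p : MvPolynomial (Fin n) k | σ p = p}) := by
  have hi := ha i
  have hΦ' := comp_algebraMap_eq_chartMap hΦ
  have hinv := diagonal_eq_self_iff (σ := σ.toAlgHom) hi hζ hσi hσj
  refine ⟨?_, (injective_of_eq_chartMap hi hΦ').injOn, ?_⟩
  · intro z hz
    induction hz using Submodule.span_induction with
    | mem z hz =>
      obtain ⟨α, c, hc, rfl⟩ := hz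
      have hs : (chartExponent a i (Finsupp.equivFunOnFinite.symm α) -
          Finsupp.single i (a i * c)) + Finsupp.single i (a i * c) =
            chartExponent a i (Finsupp.equivFunOnFinite.symm α) :=
        tsub_add_cancel_of_le <| by
          rw [Finsupp.single_le_iff]
          simpa [chartExponent] using hc
      refine ⟨monomial _ 1, (hinv _).2 fun t ht => ?_, (map_laurentMonomial hΦ' hs).symm⟩
      rw [Finset.mem_singleton.1 (support_monomial_subset ht)]
      exact (modEq_iff_exists_chartExponent _).2 ⟨_, _, hs⟩
    | zero => exact ⟨0, map_zero σ, by rw [map_zero, map_zero]⟩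
    | add y z _ _ hy hz =>
      obtain ⟨p, hp, hpy⟩ := hy
      obtain ⟨q, hq, hqz⟩ := hz
      exact ⟨p + q, (map_add σ p q).trans (congrArg₂ _ hp hq), by rw [map_add, map_add, hpy, hqz]⟩
    | smul r z _ hz =>
      obtain ⟨p, hp, hpz⟩ := hz
      exact ⟨r • p, (map_smul σ r p).trans (congrArg _ hp), by
        rw [algebraMap_away_X_smul, map_smul, hpz]⟩
  · rintro _ ⟨p, hp, rfl⟩
    have hp := (hinv p).1 hp
    rw [← AlgHom.coe_toLinearMap, ← Submodule.map_coe, SetLike.mem_coe, p.as_sum, map_sum]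
    refine Submodule.sum_mem _ fun s hs => ?_
    obtain ⟨α, c, hαc⟩ := (modEq_iff_exists_chartExponent s).1 (hp s hs)
    rw [← mul_one (coeff s p), ← smul_eq_mul, ← smul_monomial, algebraMap_away_X_smul]
    refine Submodule.smul_mem _ _ ⟨_, Submodule.subset_span ⟨α, c, ?_, rfl⟩,
      map_laurentMonomial hΦ' hαc⟩
    have := DFunLike.congr_fun hαc i
    simp only [chartExponent, Finsupp.coe_update, Finsupp.add_apply, Finsupp.single_eq_same,
      Function.update_self] at this
    omega
end
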